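/- Let p be a natural number, b ∈ ℝ with b ≠ 0, c > 0, q > 0, x0 ≥ 0. Define G(x) = (p+1)^(-1/q) + ((x-x0)/c)^b, g(x) = (b/c)·((x-x0)/c)^(b-1), and the IF density f(x) = sign(b)·q·g(x)·G(x)^(-q-1)·(1 - G(x)^(-q)/(p+1))^p for x ≥ x0. Then the differential entropy -∫_{x0}^∞ f(x)·ln(f(x)) dx equals -ln(|b|q/c) - ((b-1)/b)·F(p,q) - ((b·q+1)/(b·q))·ln(p+1) + ((q+1)/q)·H_{p+1} + p/(p+1), where F(p,q) = (p+1)·∫_0^1 ln(t^(-1/q) - 1)·(1-t)^p dt and H_{p+1} = Σ_{k=1}^{p+1} 1/k. -/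

import Mathlib

open MeasureTheory Real

lemma int_log (p : ℕ) : ∫ t in (0:ℝ)..1, log t * (1-t)^p =
    - (∑ k ∈ Finset.range (p + 1), (1 : ℝ) / (k + 1)) / (p+1) := by
  have hp : (p:ℝ)+1 ≠ 0 := by positivity
  have h := intervalIntegral.integral_eq_sub_of_hasDerivAt_of_le (a := (0:ℝ)) (b := 1)
    (f := fun t => (t * log t) * (∑ k ∈ Finset.range (p+1), (1-t)^k) / (p+1)
      + (∑ k ∈ Finset.range (p+1), (1-t)^(k+1) / (k+1)) / (p+1))
    (f' := fun t => log t * (1-t)^p) zero_le_one ?_ ?_ ?_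
  · rw [h]
    simp
    ring
  · refine Continuous.continuousOn ?_
    have := Real.continuous_mul_log
    fun_prop
  · intro t ht
    have ht0 : t ≠ 0 := ht.1.ne'
    have key : ∀ s : ℝ, s * (∑ k ∈ Finset.range (p+1), (1-s)^k) = 1 - (1-s)^(p+1) := by
      intro s
      have := geom_sum_mul (1-s) (p+1)
      linear_combination -this
    have h1 : HasDerivAt (fun s : ℝ => (1 - (1-s)^(p+1)) * log s / (p+1)
        + (∑ k ∈ Finset.range (p+1), (1-s)^(k+1) / (k+1)) / (p+1))
        ((((p+1) * (1-t)^p) * log t + (1 - (1-t)^(p+1)) * t⁻¹) / (p+1)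
        + (∑ k ∈ Finset.range (p+1), (-(1-t)^k)) / (p+1)) t := by
      have h0 : HasDerivAt (fun s : ℝ => 1 - s) (-1) t := by
        simpa using (hasDerivAt_id t).const_sub 1
      refine HasDerivAt.add (HasDerivAt.div_const (HasDerivAt.mul ?_ (Real.hasDerivAt_log ht0)) _) (HasDerivAt.div_const ?_ _)
      · have := (h0.pow (p+1)).const_sub 1
        refine this.congr_deriv ?_
        push_cast; simp
      · refine HasDerivAt.fun_sum fun k _ => ?_
        have := (h0.pow (k+1)).div_const ((k:ℝ)+1)
        refine this.congr_deriv ?_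
        have : (k:ℝ)+1 ≠ 0 := by positivity
        push_cast; simp; field_simp
    have h2 : (fun s : ℝ => (s * log s) * (∑ k ∈ Finset.range (p+1), (1-s)^k) / (p+1)
      + (∑ k ∈ Finset.range (p+1), (1-s)^(k+1) / (k+1)) / (p+1)) = (fun s : ℝ => (1 - (1-s)^(p+1)) * log s / (p+1)
        + (∑ k ∈ Finset.range (p+1), (1-s)^(k+1) / ((k:ℝ)+1)) / (p+1)) := by
      ext s; rw [← key s]; ring
    rw [h2]
    refine h1.congr_deriv ?_
    rw [← key t, Finset.sum_neg_distrib]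
    field_simp
    ring
  · exact intervalIntegral.intervalIntegrable_log'.mul_continuousOn (by fun_prop)

lemma int_log1 (p : ℕ) : ∫ t in (0:ℝ)..1, log (1-t) * (1-t)^p = - 1 / ((p:ℝ)+1)^2 := by
  have hp : (p:ℝ)+1 ≠ 0 := by positivity
  rw [intervalIntegral.integral_comp_sub_left (fun s => log s * s^p) 1]
  simp only [sub_self, sub_zero]
  rw [intervalIntegral.integral_eq_sub_of_hasDerivAt_of_le (a := (0:ℝ)) (b := 1)
    (f := fun s => s^p * (s * log s) / (p+1) - s^(p+1)/(p+1)^2)  zero_le_one]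
  · simp; ring
  · have := Real.continuous_mul_log
    exact Continuous.continuousOn (by fun_prop)
  · intro t ht
    have ht0 : t ≠ 0 := ht.1.ne'
    have h := (((hasDerivAt_pow (p+1) t).mul (Real.hasDerivAt_log ht0)).div_const ((p:ℝ)+1)).sub
      ((hasDerivAt_pow (p+1) t).div_const (((p:ℝ)+1)^2))
    refine (h.congr_deriv ?_).congr_of_eventuallyEq (Filter.Eventually.of_forall fun s => ?_)
    · push_cast; field_simp; ring
    · simp; ring
  · exact intervalIntegral.intervalIntegrable_log'.mul_continuousOn (by fun_prop)

lemma ii_log1 : IntervalIntegrable (fun t => log (1-t)) volume 0 1 := by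
  have := (intervalIntegral.intervalIntegrable_log' (a := 0) (b := 1)).comp_sub_left 1
  simpa using this.symm

lemma ii_F (a : ℝ) (ha : 0 < a) : IntervalIntegrable (fun t => log (t^(-a) - 1)) volume 0 1 := by
  have h1 : IntervalIntegrable (fun t => log (1 - t^a)) volume 0 1 := by
    have hm : 0 < min 1 a := lt_min one_pos ha
    refine IntervalIntegrable.mono_fun' (g := fun t => -(log (min 1 a) + log (1-t)))
      ((by simp : IntervalIntegrable (fun _ => log (min 1 a)) volume 0 1).add ii_log1).neg
      (Measurable.aestronglyMeasurable (by fun_prop)) ?_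
    rw [Set.uIoc_of_le zero_le_one, ← Measure.restrict_congr_set Ioo_ae_eq_Ioc]
    refine (ae_restrict_iff' measurableSet_Ioo).2 (Filter.Eventually.of_forall fun t ht => ?_)
    have ht1 : t ^ a < 1 := Real.rpow_lt_one ht.1.le ht.2 ha
    have ht2 : 0 < t ^ a := Real.rpow_pos_of_pos ht.1 a
    have h3 : min 1 a * (1-t) ≤ 1 - t^a := by
      rcases le_total 1 a with h | h
      · rw [min_eq_left h]
        have := Real.rpow_le_rpow_of_exponent_ge ht.1 ht.2.le h
        rw [rpow_one] at this
        linarith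
      · rw [min_eq_right h]
        have := rpow_one_add_le_one_add_mul_self (s := t - 1) (by linarith [ht.1]) ha.le h
        rw [add_sub_cancel] at this
        linarith
    have h4 : 0 < 1 - t := by linarith [ht.2]
    beta_reduce
    rw [← Real.log_mul hm.ne' h4.ne', Real.norm_eq_abs, abs_of_nonpos (Real.log_nonpos (by linarith) (by linarith))]
    exact neg_le_neg (Real.log_le_log (by positivity) h3)
  refine IntervalIntegrable.congr_ae (f := fun t => -a * log t + log (1 - t^a)) ((intervalIntegral.intervalIntegrable_log'.const_mul _).add h1) ?_
  rw [Set.uIoc_of_le zero_le_one, ← Measure.restrict_congr_set Ioo_ae_eq_Ioc]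
  refine (ae_restrict_iff' measurableSet_Ioo).2 (Filter.Eventually.of_forall fun t ht => ?_)
  have ht1 : t ^ a < 1 := Real.rpow_lt_one ht.1.le ht.2 ha
  have ht2 : 0 < t ^ a := Real.rpow_pos_of_pos ht.1 a
  have : t^(-a) - 1 = t^(-a) * (1 - t^a) := by
    rw [mul_sub, ← Real.rpow_add ht.1]; simp
  simp only
  rw [this, Real.log_mul (Real.rpow_pos_of_pos ht.1 _).ne' (by linarith), Real.log_rpow ht.1]

/-- The differential entropy of the IF distribution with natural interpolation
parameter `p`. -/
theorem if_entropy (p : ℕ) (b c q x0 : ℝ) (hb : b ≠ 0) (hc : 0 < c) (hq : 0 < q)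
    (hx0 : 0 ≤ x0)
    (G : ℝ → ℝ) (hG : ∀ x, G x = ((p : ℝ) + 1) ^ (-1 / q) + ((x - x0) / c) ^ b)
    (g : ℝ → ℝ) (hg : ∀ x, g x = b / c * ((x - x0) / c) ^ (b - 1))
    (f : ℝ → ℝ)
    (hf : ∀ x, f x =
      Real.sign b * q * g x * G x ^ (-q - 1) * (1 - G x ^ (-q) / ((p : ℝ) + 1)) ^ p) :
    -∫ x in Set.Ioi x0, f x * Real.log (f x) =
      -Real.log (|b| * q / c) -
        (b - 1) / b *
          (((p : ℝ) + 1) * ∫ t in (0:ℝ)..1, Real.log (t ^ (-1 / q) - 1) * (1 - t) ^ p) -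
        (b * q + 1) / (b * q) * Real.log ((p : ℝ) + 1) +
        (q + 1) / q * (∑ k ∈ Finset.range (p + 1), (1 : ℝ) / (k + 1)) +
        (p : ℝ) / ((p : ℝ) + 1) := by
  have hp : 0 < (p:ℝ)+1 := by positivity
  have hpow : ∫ t in (0:ℝ)..1, (1-t)^p = 1 / ((p:ℝ)+1) := by
    rw [intervalIntegral.integral_comp_sub_left (fun s => s^p) 1]
    simp
  have hI1 := int_log p
  have hI2 := int_log1 p
  have hJ0 : IntervalIntegrable (fun t : ℝ => (1-t)^p) volume 0 1 :=
    Continuous.intervalIntegrable (by fun_prop) _ _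
  have hJ1 : IntervalIntegrable (fun t : ℝ => log t * (1-t)^p) volume 0 1 :=
    intervalIntegral.intervalIntegrable_log'.mul_continuousOn (by fun_prop)
  have hJ2 : IntervalIntegrable (fun t : ℝ => log (1-t) * (1-t)^p) volume 0 1 :=
    ii_log1.mul_continuousOn (by fun_prop)
  have hJ3 : IntervalIntegrable (fun t : ℝ => log (t^(-1/q)-1) * (1-t)^p) volume 0 1 := by
    have := ii_F (1/q) (by positivity)
    rw [← neg_div] at this
    exact this.mul_continuousOn (by fun_prop)
  set m : ℝ := (p:ℝ)+1 with hm
  set A : ℝ := m ^ (-1/q) with hA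
  have hA0 : 0 < A := Real.rpow_pos_of_pos hp _
  have hlogA : log A = -1/q * log m := Real.log_rpow hp _
  have hAq : A ^ (-q) = m := by
    rw [hA, ← Real.rpow_mul hp.le]
    rw [show -1/q * -q = 1 by field_simp, rpow_one]
  set φ : ℝ → ℝ := fun x => G x ^ (-q) / m with hφ
  set C0 : ℝ := log (|b| * q / c) + (b-1)/b * log A + (-q-1) * log A with hC0
  set K : ℝ → ℝ := fun t => m * (C0 * (1-t)^p + (b-1)/b * (log (t^(-1/q)-1) * (1-t)^p)
    + (q+1)/q * (log t * (1-t)^p) + p * (log (1-t) * (1-t)^p)) with hK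
  have hu : ∀ x ∈ Set.Ioi x0, 0 < (x-x0)/c := fun x hx => div_pos (sub_pos.2 hx) hc
  have hGA : ∀ x ∈ Set.Ioi x0, A < G x := fun x hx => by
    rw [hG]; linarith [Real.rpow_pos_of_pos (hu x hx) b]
  have hG0 : ∀ x ∈ Set.Ioi x0, 0 < G x := fun x hx => hA0.trans (hGA x hx)
  have hφ0 : ∀ x ∈ Set.Ioi x0, 0 < φ x := fun x hx =>
    div_pos (Real.rpow_pos_of_pos (hG0 x hx) _) hp
  have hφ1 : ∀ x ∈ Set.Ioi x0, φ x < 1 := fun x hx => by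
    rw [hφ]; simp only
    rw [div_lt_one hp, ← hAq]
    exact Real.rpow_lt_rpow_of_neg hA0 (hGA x hx) (by linarith)
  have hφinv : ∀ x ∈ Set.Ioi x0, φ x ^ (-1/q) * A = G x := fun x hx => by
    have h1 := (Real.rpow_pos_of_pos (hG0 x hx) (-q)).le
    rw [hφ]; simp only
    rw [Real.div_rpow h1 hp.le, div_mul_cancel₀ _ hA0.ne', ← Real.rpow_mul (hG0 x hx).le,
      show -q * (-1/q) = 1 by field_simp, rpow_one]
  have hder : ∀ x ∈ Set.Ioi x0, HasDerivWithinAt φ (g x * (-q) * G x ^ (-q-1) / m) (Set.Ioi x0) x := by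
    intro x hx
    have h1 : HasDerivAt (fun x => (x-x0)/c) (1/c) x := ((hasDerivAt_id x).sub_const x0).div_const c
    have h2 := (h1.rpow_const (p := b) (Or.inl (hu x hx).ne')).const_add A
    have h3 : HasDerivAt G (g x) x := by
      rw [show G = fun x => A + ((x-x0)/c)^b from funext hG]
      refine h2.congr_deriv ?_
      rw [hg]; ring
    exact ((h3.rpow_const (p := -q) (Or.inl (hG0 x hx).ne')).div_const m).hasDerivWithinAt
  have hinj : Set.InjOn φ (Set.Ioi x0) := by
    intro x hx y hy hxy
    have h1 : G x = G y := by rw [← hφinv x hx, ← hφinv y hy, hxy]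
    rw [hG, hG] at h1
    have h2 := Real.rpow_left_injOn hb (hu x hx).le (hu y hy).le (add_left_cancel h1)
    field_simp at h2
    linarith
  have himg : φ '' Set.Ioi x0 = Set.Ioo 0 1 := by
    apply Set.Subset.antisymm
    · rintro _ ⟨x, hx, rfl⟩
      exact ⟨hφ0 x hx, hφ1 x hx⟩
    · intro t ht
      have hv : 0 < A * (t^(-1/q) - 1) := by
        refine mul_pos hA0 (sub_pos.2 ?_)
        exact Real.one_lt_rpow_of_pos_of_lt_one_of_neg ht.1 ht.2 (div_neg_of_neg_of_pos (by norm_num) hq)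
      have hw := Real.rpow_pos_of_pos hv (1/b)
      refine ⟨x0 + c * (A * (t^(-1/q) - 1))^(1/b), ?_, ?_⟩
      · simp only [Set.mem_Ioi]
        linarith [mul_pos hc hw]
      · have h1 : G (x0 + c * (A * (t^(-1/q) - 1))^(1/b)) = A * t^(-1/q) := by
          rw [hG, add_sub_cancel_left, mul_div_cancel_left₀ _ hc.ne', ← Real.rpow_mul hv.le,
            one_div_mul_cancel hb, rpow_one]
          ring
        rw [hφ]; simp only
        rw [h1, Real.mul_rpow hA0.le (Real.rpow_pos_of_pos ht.1 _).le, hAq, ← Real.rpow_mul ht.1.le,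
          show -1/q * -q = 1 by field_simp, rpow_one]
        field_simp
  have hsub := integral_image_eq_integral_abs_deriv_smul measurableSet_Ioi hder hinj K
  have hbs : Real.sign b * b = |b| := by
    rcases lt_or_gt_of_ne hb with h | h
    · rw [Real.sign_of_neg h, abs_of_neg h]; ring
    · rw [Real.sign_of_pos h, abs_of_pos h]; ring
  have hb0 : 0 < |b| := abs_pos.2 hb
  have hint : ∫ x in Set.Ioi x0, f x * Real.log (f x) =
      ∫ x in Set.Ioi x0, |g x * (-q) * G x ^ (-q-1) / m| • K (φ x) := by
    refine setIntegral_congr_fun measurableSet_Ioi fun x hx => ?_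
    have hux := hu x hx
    have hGx := hG0 x hx
    have hub := Real.rpow_pos_of_pos hux (b-1)
    have hGq := Real.rpow_pos_of_pos hGx (-q-1)
    have h1φ : 0 < 1 - φ x := sub_pos.2 (hφ1 x hx)
    have hfx : f x = (|b| * q / c) * ((x-x0)/c)^(b-1) * G x ^ (-q-1) * (1 - φ x)^p := by
      rw [hf, hg, ← hbs]; ring
    have hlog : log (f x) = log (|b| * q / c) + (b-1) * log ((x-x0)/c) + (-q-1) * log (G x)
        + p * log (1 - φ x) := by
      rw [hfx, Real.log_mul (by positivity) (by positivity), Real.log_mul (by positivity) (by positivity),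
        Real.log_mul (by positivity) (by positivity), Real.log_rpow hux, Real.log_rpow hGx, Real.log_pow]
    have habs : |g x * (-q) * G x ^ (-q-1) / m| = (|b| * q / c) * ((x-x0)/c)^(b-1) * G x ^ (-q-1) / m := by
      rw [hg]
      simp only [abs_mul, abs_div, abs_neg, abs_of_pos hq, abs_of_pos hc, abs_of_pos hub, abs_of_pos hGq,
        abs_of_pos hp]
      ring
    have hlogG : log (G x) = -1/q * log (φ x) + log A := by
      rw [← hφinv x hx, Real.log_mul (Real.rpow_pos_of_pos (hφ0 x hx) _).ne' hA0.ne',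
        Real.log_rpow (hφ0 x hx)]
    have hlogu : b * log ((x-x0)/c) = log A + log (φ x ^ (-1/q) - 1) := by
      have h2 : ((x-x0)/c)^b = A * (φ x ^ (-1/q) - 1) := by
        have := hφinv x hx
        rw [hG] at this
        linarith
      have h3 : 0 < A * (φ x ^ (-1/q) - 1) := h2 ▸ Real.rpow_pos_of_pos hux b
      have h4 := (pos_iff_pos_of_mul_pos h3).1 hA0
      rw [← Real.log_rpow hux, h2, Real.log_mul hA0.ne' h4.ne']
    have hlogu' : log ((x-x0)/c) = (log A + log (φ x ^ (-1/q) - 1)) / b := by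
      rw [← hlogu]; field_simp
    beta_reduce
    rw [hlog, habs, hlogu', hlogG, hfx, hK, hC0, smul_eq_mul]
    simp only
    field_simp
    ring
  have hKint : ∫ t in Set.Ioo (0:ℝ) 1, K t = ∫ t in (0:ℝ)..1, K t := by
    rw [intervalIntegral.integral_of_le zero_le_one, integral_Ioc_eq_integral_Ioo]
  rw [hint, ← hsub, himg, hKint, hK]
  rw [intervalIntegral.integral_const_mul,
    intervalIntegral.integral_add (((hJ0.const_mul _).add (hJ3.const_mul _)).add (hJ1.const_mul _)) (hJ2.const_mul _),
    intervalIntegral.integral_add ((hJ0.const_mul _).add (hJ3.const_mul _)) (hJ1.const_mul _),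
    intervalIntegral.integral_add (hJ0.const_mul _) (hJ3.const_mul _)]
  simp only [intervalIntegral.integral_const_mul]
  rw [hpow, hI1, hI2, hC0, hlogA]
  generalize (∑ k ∈ Finset.range (p + 1), (1 : ℝ) / (k + 1)) = S
  generalize (∫ t in (0:ℝ)..1, Real.log (t ^ (-1 / q) - 1) * (1 - t) ^ p) = I
  field_simp
  ring
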